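/- Let d ≥ 1, L ≥ 2, Φ ∈ ℝ^{d×d} and W_1,…,W_L ∈ ℝ^{d×d}. If W_l W_lᵀ = W_{l+1}ᵀ W_{l+1} for all l = 1,…,L−2 and W_{L−1} W_{L−1}ᵀ = I + W_Lᵀ W_L, then the gradient with respect to the last layer satisfies ‖∇_L R‖_F² ≥ 2 R. -/

import Mathlib

open Matrix

namespace ZAS

/-- `seg W l₁ l₂ = W l₂ * W (l₂-1) * ⋯ * W l₁` (the empty product, when `l₂ < l₁`, is `1`). -/
noncomputable def seg {d : ℕ} (W : ℕ → Matrix (Fin d) (Fin d) ℝ) (l₁ : ℕ) :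
    ℕ → Matrix (Fin d) (Fin d) ℝ
  | 0 => 1
  | (k+1) => if k + 1 < l₁ then 1 else W (k+1) * seg W l₁ k

/-- Squared Frobenius norm `‖A‖_F²`. -/
noncomputable def frobSq {m n : ℕ} (A : Matrix (Fin m) (Fin n) ℝ) : ℝ :=
  ∑ i, ∑ j, (A i j)^2

/-- Frobenius norm `‖A‖_F`. -/
noncomputable def frob {m n : ℕ} (A : Matrix (Fin m) (Fin n) ℝ) : ℝ :=
  Real.sqrt (frobSq A)

/-- Frobenius inner product `⟨A, B⟩ = tr(Aᵀ B)`. -/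
noncomputable def finner {m n : ℕ} (A B : Matrix (Fin m) (Fin n) ℝ) : ℝ :=
  ∑ i, ∑ j, A i j * B i j

/-- The loss `R(W_1, …, W_L) = (1/2) ‖W_{L:1} - Φ‖_F²`. -/
noncomputable def loss {d : ℕ} (W : ℕ → Matrix (Fin d) (Fin d) ℝ)
    (Φ : Matrix (Fin d) (Fin d) ℝ) (L : ℕ) : ℝ :=
  frobSq (seg W 1 L - Φ) / 2

/-- The gradient `∇_l R = W_{L:l+1}ᵀ (W_{L:1} - Φ) W_{l-1:1}ᵀ`. -/
noncomputable def grad {d : ℕ} (W : ℕ → Matrix (Fin d) (Fin d) ℝ)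
    (Φ : Matrix (Fin d) (Fin d) ℝ) (L l : ℕ) : Matrix (Fin d) (Fin d) ℝ :=
  (seg W (l+1) L)ᵀ * (seg W 1 L - Φ) * (seg W 1 (l-1))ᵀ

/-- The invariant matrices `D_l = W_{l+1}ᵀ W_{l+1} - W_l W_lᵀ`. -/
noncomputable def Dmat {d : ℕ} (W : ℕ → Matrix (Fin d) (Fin d) ℝ) (l : ℕ) :
    Matrix (Fin d) (Fin d) ℝ :=
  (W (l+1))ᵀ * W (l+1) - W l * (W l)ᵀ

/-- Spectral norm (operator 2-norm) of a square real matrix. -/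
noncomputable def spec {d : ℕ} (A : Matrix (Fin d) (Fin d) ℝ) : ℝ :=
  ‖Matrix.toEuclideanCLM (𝕜 := ℝ) A‖

/-- The loss on data: `R̃ = (1/2) ‖W_{L:1} X - Y‖_F²`. -/
noncomputable def lossT {d n : ℕ} (W : ℕ → Matrix (Fin d) (Fin d) ℝ)
    (X Y : Matrix (Fin d) (Fin n) ℝ) (L : ℕ) : ℝ :=
  frobSq (seg W 1 L * X - Y) / 2

/-- The gradient of the data loss: `∇_l R̃ = W_{L:l+1}ᵀ (W_{L:1} X - Y) Xᵀ W_{l-1:1}ᵀ`. -/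
noncomputable def gradT {d n : ℕ} (W : ℕ → Matrix (Fin d) (Fin d) ℝ)
    (X Y : Matrix (Fin d) (Fin n) ℝ) (L l : ℕ) : Matrix (Fin d) (Fin d) ℝ :=
  (seg W (l+1) L)ᵀ * (seg W 1 L * X - Y) * Xᵀ * (seg W 1 (l-1))ᵀ

end ZAS

open ZAS

lemma frobSq_eq_trace {m n : ℕ} (A : Matrix (Fin m) (Fin n) ℝ) :
    frobSq A = (A * Aᵀ).trace := by
  simp [frobSq, Matrix.trace, Matrix.mul_apply, sq]

lemma seg_eq_one_of_lt {d : ℕ} (W : ℕ → Matrix (Fin d) (Fin d) ℝ) {l₁ l₂ : ℕ} (h : l₂ < l₁) :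
    seg W l₁ l₂ = 1 := by
  cases l₂ with
  | zero => rfl
  | succ k => simp [seg, h]

lemma seg_one_succ {d : ℕ} (W : ℕ → Matrix (Fin d) (Fin d) ℝ) (k : ℕ) :
    seg W 1 (k + 1) = W (k + 1) * seg W 1 k := by
  simp [seg]

/-- For balanced layers, `W_{k:1} W_{k:1}ᵀ = (W_k W_kᵀ)^k`. -/
lemma seg_mul_transpose_of_balanced {d : ℕ} (W : ℕ → Matrix (Fin d) (Fin d) ℝ) (k : ℕ)
    (hbal : ∀ l, 1 ≤ l → l < k → W l * (W l)ᵀ = (W (l + 1))ᵀ * W (l + 1)) :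
    seg W 1 k * (seg W 1 k)ᵀ = (W k * (W k)ᵀ) ^ k := by
  induction k with
  | zero => simp [seg]
  | succ k ih =>
    have ih := ih fun l h₁ h₂ => hbal l h₁ (by omega)
    have hpow : (W k * (W k)ᵀ) ^ k = ((W (k + 1))ᵀ * W (k + 1)) ^ k := by
      rcases Nat.eq_zero_or_pos k with rfl | hk
      · simp
      · rw [hbal k hk (by omega)]
    calc seg W 1 (k + 1) * (seg W 1 (k + 1))ᵀ
        = W (k + 1) * (seg W 1 k * (seg W 1 k)ᵀ) * (W (k + 1))ᵀ := by
          simp only [seg_one_succ, Matrix.transpose_mul, Matrix.mul_assoc]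
      _ = (W (k + 1) * (W (k + 1))ᵀ) ^ (k + 1) := by
          rw [ih, hpow, ← mul_pow_mul, mul_assoc, ← pow_succ]

lemma Matrix.PosSemidef.pow_mul_one_add_pow {ι : Type*} [Fintype ι] [DecidableEq ι]
    {P : Matrix ι ι ℝ} (hP : P.PosSemidef) (j n : ℕ) : (P ^ j * (1 + P) ^ n).PosSemidef := by
  induction n generalizing j with
  | zero => simpa using hP.pow j
  | succ n ih =>
    have h : P ^ j * (1 + P) ^ (n + 1) = P ^ j * (1 + P) ^ n + P ^ (j + 1) * (1 + P) ^ n := by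
      rw [pow_succ' (1 + P), pow_succ P]
      noncomm_ring
    exact h ▸ (ih j).add (ih (j + 1))

lemma Matrix.PosSemidef.one_add_pow_sub_one {ι : Type*} [Fintype ι] [DecidableEq ι]
    {P : Matrix ι ι ℝ} (hP : P.PosSemidef) (n : ℕ) : ((1 + P) ^ n - 1).PosSemidef := by
  induction n with
  | zero => simpa using Matrix.PosSemidef.zero
  | succ n ih =>
    have h : (1 + P) ^ (n + 1) - 1 = ((1 + P) ^ n - 1) + P ^ 1 * (1 + P) ^ n := by
      rw [pow_succ', pow_one]
      noncomm_ring
    exact h ▸ ih.add (hP.pow_mul_one_add_pow 1 n)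

/-- For a square matrix, `A Aᵀ ≥ 1` in the Loewner order implies `Aᵀ A ≥ 1`. -/
lemma Matrix.posSemidef_transpose_mul_self_sub_one {ι : Type*} [Fintype ι] [DecidableEq ι]
    {A : Matrix ι ι ℝ} (h : (A * Aᵀ - 1).PosSemidef) : (Aᵀ * A - 1).PosSemidef := by
  have hS : (A * Aᵀ).PosDef := by
    simpa using Matrix.PosDef.one.add_posSemidef h
  have hA : IsUnit A.det := by
    have := hS.det_pos.ne'
    rw [Matrix.det_mul, Matrix.det_transpose] at this
    exact (left_ne_zero_of_mul this).isUnit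
  have hAt : IsUnit Aᵀ.det := by rwa [Matrix.det_transpose]
  have hsq := (h.pow 2).add h
  have hconj := hsq.mul_mul_conjTranspose_same A⁻¹
  have e₁ : (A * Aᵀ - 1) ^ 2 + (A * Aᵀ - 1) = A * (Aᵀ * A - 1) * Aᵀ := by
    noncomm_ring
  have e₂ : A⁻¹ * (A * (Aᵀ * A - 1) * Aᵀ) * (A⁻¹)ᴴ = Aᵀ * A - 1 := by
    rw [Matrix.conjTranspose_eq_transpose_of_trivial, Matrix.transpose_nonsing_inv,
      ← Matrix.mul_assoc, Matrix.mul_nonsing_inv_cancel_right _ _ hAt,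
      Matrix.nonsing_inv_mul_cancel_left _ _ hA]
  rwa [e₁, e₂] at hconj

lemma frobSq_le_frobSq_mul_transpose {m n : ℕ} (E : Matrix (Fin m) (Fin n) ℝ)
    {A : Matrix (Fin n) (Fin n) ℝ} (h : (A * Aᵀ - 1).PosSemidef) :
    frobSq E ≤ frobSq (E * Aᵀ) := by
  have htr := ((Matrix.posSemidef_transpose_mul_self_sub_one h).mul_mul_conjTranspose_same
    E).trace_nonneg
  have e : E * (Aᵀ * A - 1) * Eᴴ = E * Aᵀ * (E * Aᵀ)ᵀ - E * Eᵀ := by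
    simp [Matrix.mul_sub, Matrix.sub_mul, Matrix.mul_assoc]
  rw [e, Matrix.trace_sub] at htr
  rw [frobSq_eq_trace, frobSq_eq_trace]
  linarith

/-- under exact balancedness, the gradient of the last layer satisfies
`‖∇_L R‖_F² ≥ 2 R`. -/
theorem balanced_last_layer_gradient_lower_bound
    (d L : ℕ) (hd : 1 ≤ d) (hL : 2 ≤ L)
    (Φ : Matrix (Fin d) (Fin d) ℝ)
    (W : ℕ → Matrix (Fin d) (Fin d) ℝ)
    (hbal : ∀ l, 1 ≤ l → l ≤ L - 2 → W l * (W l)ᵀ = (W (l+1))ᵀ * W (l+1))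
    (hlast : W (L-1) * (W (L-1))ᵀ = 1 + (W L)ᵀ * W L) :
    2 * loss W Φ L ≤ frobSq (grad W Φ L L) := by
  have hgrad : grad W Φ L L = (seg W 1 L - Φ) * (seg W 1 (L - 1))ᵀ := by
    simp [grad, seg_eq_one_of_lt W (Nat.lt_succ_self L)]
  have hP : ((W L)ᵀ * W L).PosSemidef := by
    simpa using Matrix.posSemidef_conjTranspose_mul_self (W L)
  have hA : (seg W 1 (L - 1) * (seg W 1 (L - 1))ᵀ - 1).PosSemidef := by
    rw [seg_mul_transpose_of_balanced W (L - 1) fun l h₁ h₂ => hbal l h₁ (by omega), hlast]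
    exact hP.one_add_pow_sub_one (L - 1)
  rw [hgrad, loss, mul_div_cancel₀ _ two_ne_zero]
  exact frobSq_le_frobSq_mul_transpose _ hA
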